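/- Let c > 1 with c not an integer and f(k) = ⌊k^c⌋. For every A > 1, B > 0 and C₅ > 0 there exist κ > 0 and x₀ ≥ 2 (depending only on c, A, B, C₅) such that the following holds for all x ≥ x₀: if K, K₁ are reals with K ≤ K₁ ≤ 2K and x (log x)^{−B} ≤ K^c ≤ x, if q is an integer with 1 < q ≤ (log x)^{C₅}, and ℓ is any integer, then | #{ k ∈ ℤ : K < k ≤ K₁, ⌊k^c⌋ ≡ ℓ (mod q) } − (K₁ − K)/q | ≤ κ K (log x)^{−4A}. -/

import Mathlib

/-- The additive character `t ↦ exp (2πit)` of `ℝ`, with values in `ℂ`. -/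
noncomputable def unitExp (t : ℝ) : ℂ := Complex.exp ((2 * Real.pi * t : ℝ) * Complex.I)

lemma norm_unitExp (t : ℝ) : ‖unitExp t‖ = 1 := Complex.norm_exp_ofReal_mul_I _

lemma unitExp_add (s t : ℝ) : unitExp (s + t) = unitExp s * unitExp t := by
  unfold unitExp
  rw [← Complex.exp_add]
  congr 1
  push_cast
  ring

lemma unitExp_zero : unitExp 0 = 1 := by simp [unitExp]

lemma unitExp_intCast (n : ℤ) : unitExp n = 1 := by
  rw [unitExp, Complex.exp_eq_one_iff]
  exact ⟨n, by push_cast; ring⟩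

lemma unitExp_nsmul (n : ℕ) (t : ℝ) : unitExp (n * t) = unitExp t ^ n := by
  rw [unitExp, unitExp, ← Complex.exp_nat_mul]
  congr 1
  push_cast
  ring

lemma conj_unitExp (t : ℝ) : (starRingEnd ℂ) (unitExp t) = unitExp (-t) := by
  rw [unitExp, unitExp, ← Complex.exp_conj]
  congr 1
  rw [map_mul, Complex.conj_I, Complex.conj_ofReal]
  push_cast
  ring

lemma unitExp_sub (s t : ℝ) :
    unitExp (s - t) = unitExp s * (starRingEnd ℂ) (unitExp t) := by
  rw [conj_unitExp, ← unitExp_add, sub_eq_add_neg]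

lemma norm_unitExp_sub_one (t : ℝ) : ‖unitExp t - 1‖ = 2 * |Real.sin (Real.pi * t)| := by
  have h := Complex.norm_exp_I_mul_ofReal_sub_one (2 * Real.pi * t)
  rw [unitExp, mul_comm, h, norm_mul, Real.norm_eq_abs, Real.norm_eq_abs, abs_two]
  congr 3
  ring

lemma norm_unitExp_sub (s t : ℝ) : ‖unitExp s - unitExp t‖ ≤ 2 * Real.pi * |s - t| := by
  have h : unitExp s - unitExp t = (unitExp (s - t) - 1) * unitExp t := by
    rw [sub_mul, ← unitExp_add, one_mul, sub_add_cancel]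
  rw [h, norm_mul, norm_unitExp, mul_one, norm_unitExp_sub_one]
  have := Real.abs_sin_le_abs (x := Real.pi * (s - t))
  rw [abs_mul, abs_of_pos Real.pi_pos] at this
  linarith

lemma four_mul_le_norm_unitExp_sub_one {t : ℝ} (h : |t| ≤ 1 / 2) :
    4 * |t| ≤ ‖unitExp t - 1‖ := by
  rw [norm_unitExp_sub_one]
  have h1 : |Real.pi * t| ≤ Real.pi / 2 := by
    rw [abs_mul, abs_of_pos Real.pi_pos]
    nlinarith [Real.pi_pos]
  have h2 := Real.mul_abs_le_abs_sin h1
  rw [abs_mul, abs_of_pos Real.pi_pos] at h2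
  have h3 : 2 / Real.pi * (Real.pi * |t|) = 2 * |t| := by
    field_simp
  linarith

open fwdDiff in
/-- The Kusmin–Landau inequality. -/
lemma norm_sum_unitExp_le_inv {F : ℕ → ℝ} {N : ℕ} {lam : ℝ} (hlam : 0 < lam)
    (hlow : ∀ n < N, lam ≤ Δ_[1] F n) (hup : ∀ n < N, Δ_[1] F n ≤ 1 / 2)
    (hmono : ∀ n < N, Δ_[1] F (n + 1) ≤ Δ_[1] F n) :
    ‖∑ n ∈ Finset.range N, unitExp (F n)‖ ≤ 1 / lam := by
  rcases Nat.eq_zero_or_pos N with rfl | hN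
  · simp [hlam.le]
  obtain ⟨M, rfl⟩ : ∃ M, N = M + 1 := ⟨N - 1, by omega⟩
  set d : ℕ → ℝ := Δ_[1] F with hd
  set w : ℕ → ℂ := fun n ↦ 1 / (unitExp (d n) - 1) with hw
  have hF : ∀ n, F (n + 1) = d n + F n := fun n ↦ by simp [hd, fwdDiff]
  have hpos : ∀ n < M + 1, 0 < d n := fun n hn ↦ hlam.trans_le (hlow n hn)
  have hbd : ∀ n < M + 1, 4 * d n ≤ ‖unitExp (d n) - 1‖ := fun n hn ↦ by
    have := four_mul_le_norm_unitExp_sub_one (t := d n)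
      (by rw [abs_of_pos (hpos n hn)]; exact hup n hn)
    rwa [abs_of_pos (hpos n hn)] at this
  have hne : ∀ n < M + 1, unitExp (d n) - 1 ≠ 0 := fun n hn ↦ by
    have := hbd n hn
    have h2 := hpos n hn
    exact norm_pos_iff.1 (by linarith)
  have hwn : ∀ n < M + 1, ‖w n‖ ≤ 1 / (4 * lam) := fun n hn ↦ by
    rw [hw]
    simp only [norm_div, norm_one]
    exact one_div_le_one_div_of_le (by positivity) (by linarith [hbd n hn, hlow n hn])
  have hwd : ∀ n, n + 1 < M + 1 →
      ‖w n - w (n + 1)‖ ≤ Real.pi / 8 * (1 / d (n + 1) - 1 / d n) := fun n hn ↦ by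
    have h0 := hpos n (by omega)
    have h1 := hpos (n + 1) hn
    have e1 : w n - w (n + 1) = (unitExp (d (n + 1)) - unitExp (d n)) /
        ((unitExp (d n) - 1) * (unitExp (d (n + 1)) - 1)) := by
      have := hne n (by omega)
      have := hne (n + 1) hn
      simp only [hw]
      field_simp
      ring
    rw [e1, norm_div, norm_mul]
    have h2 := norm_unitExp_sub (d (n + 1)) (d n)
    rw [abs_sub_comm, abs_of_nonneg (sub_nonneg.2 (hmono n (by omega)))] at h2
    have h3 : (4 * d n) * (4 * d (n + 1)) ≤
        ‖unitExp (d n) - 1‖ * ‖unitExp (d (n + 1)) - 1‖ :=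
      mul_le_mul (hbd n (by omega)) (hbd _ hn) (by positivity) (by positivity)
    calc _ ≤ 2 * Real.pi * (d n - d (n + 1)) / ((4 * d n) * (4 * d (n + 1))) :=
          div_le_div₀ ((norm_nonneg _).trans h2) h2 (by positivity) h3
      _ = _ := by field_simp; ring
  have key : ∀ m < M + 1, ‖∑ n ∈ Finset.range (m + 1), unitExp (F n) -
      w m * unitExp (F (m + 1)) + w 0 * unitExp (F 0)‖ ≤
        Real.pi / 8 * (1 / d m - 1 / d 0) := by
    have hu : ∀ m < M + 1, w m * unitExp (F (m + 1)) = unitExp (F m) + w m * unitExp (F m) := by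
      intro m hm
      have := hne m hm
      rw [hF, unitExp_add]
      simp only [hw]
      field_simp
      ring
    intro m
    induction m with
    | zero =>
      intro hm
      rw [hu 0 hm]
      simp
    | succ m ih =>
      intro hm
      have h1 := ih (by omega)
      have h2 := hwd m hm
      rw [Finset.sum_range_succ, hu (m + 1) hm]
      have e : ∑ n ∈ Finset.range (m + 1), unitExp (F n) + unitExp (F (m + 1)) -
          (unitExp (F (m + 1)) + w (m + 1) * unitExp (F (m + 1))) + w 0 * unitExp (F 0) =
          (∑ n ∈ Finset.range (m + 1), unitExp (F n) -
            w m * unitExp (F (m + 1)) + w 0 * unitExp (F 0)) +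
          (w m - w (m + 1)) * unitExp (F (m + 1)) := by ring
      rw [e]
      refine (norm_add_le _ _).trans ?_
      rw [norm_mul, norm_unitExp, mul_one]
      linarith
  have hk := key M (by omega)
  have e : ∑ n ∈ Finset.range (M + 1), unitExp (F n) =
      (∑ n ∈ Finset.range (M + 1), unitExp (F n) -
        w M * unitExp (F (M + 1)) + w 0 * unitExp (F 0)) + w M * unitExp (F (M + 1)) -
        w 0 * unitExp (F 0) := by ring
  rw [e]
  refine (norm_sub_le _ _).trans ((add_le_add_left (norm_add_le _ _) _).trans ?_)
  simp only [norm_mul, norm_unitExp, mul_one]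
  have h1 := hwn M (by omega)
  have h0 := hwn 0 (by omega)
  have h2 : 1 / d M ≤ 1 / lam := one_div_le_one_div_of_le hlam (hlow M (by omega))
  have h3 : 0 < 1 / d 0 := one_div_pos.2 (hpos 0 (by omega))
  have h4 : Real.pi / 8 * (1 / d M - 1 / d 0) ≤ 1 / 2 * (1 / lam) := by
    have := Real.pi_lt_four
    have h5 : 0 < 1 / lam := by positivity
    calc _ ≤ Real.pi / 8 * (1 / lam) := by
          apply mul_le_mul_of_nonneg_left _ (by positivity); linarith
      _ ≤ _ := by apply mul_le_mul_of_nonneg_right _ h5.le; linarith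
  have h5 : 1 / (4 * lam) = 1 / 4 * (1 / lam) := by field_simp
  linarith

/-- A form of van der Corput's inequality. -/
lemma van_der_corput {u : ℕ → ℂ} (hu : ∀ n, ‖u n‖ ≤ 1) (N H : ℕ) {E : ℝ} (hE0 : 0 ≤ E)
    (hE : ∀ h, 1 ≤ h → h < H →
      ‖∑ n ∈ Finset.range (N - h), u (n + h) * (starRingEnd ℂ) (u n)‖ ≤ E) :
    (H * ‖∑ n ∈ Finset.range N, u n‖) ^ 2 ≤ (N + H) * (H * N + H ^ 2 * E) := by
  set w : ℕ → ℕ → ℂ := fun j k ↦ if j ≤ k ∧ k - j < N then u (k - j) else 0 with hw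
  set v : ℕ → ℂ := fun k ↦ ∑ j ∈ Finset.range H, w j k with hv
  have hsum : ∀ j ∈ Finset.range H,
      ∑ k ∈ Finset.range (N + H), w j k = ∑ n ∈ Finset.range N, u n := by
    intro j hj
    rw [Finset.mem_range] at hj
    symm
    refine Finset.sum_of_injOn (fun n ↦ n + j) ?_ ?_ ?_ ?_
    · intro a _ b _ h
      simpa using h
    · intro a ha
      simp only [Finset.coe_range, Set.mem_Iio] at ha ⊢
      omega
    · intro k _ hk2
      simp only [hw]
      rw [if_neg]
      rintro ⟨h1, h2⟩
      exact hk2 ⟨k - j, by simpa using h2, by simp only; omega⟩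
    · intro n hn
      rw [Finset.mem_range] at hn
      simp [hw, hn]
  have hcorr : ∀ j j', j ≤ j' → j' < H →
      ∑ k ∈ Finset.range (N + H), w j k * (starRingEnd ℂ) (w j' k) =
        ∑ n ∈ Finset.range (N - (j' - j)),
          u (n + (j' - j)) * (starRingEnd ℂ) (u n) := by
    intro j j' hjj hj'
    symm
    refine Finset.sum_of_injOn (fun n ↦ n + j') ?_ ?_ ?_ ?_
    · intro a _ b _ h
      simpa using h
    · intro a ha
      simp only [Finset.coe_range, Set.mem_Iio] at ha ⊢
      omega
    · intro k _ hk2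
      simp only [hw]
      by_cases h1 : j ≤ k ∧ k - j < N
      · by_cases h2 : j' ≤ k ∧ k - j' < N
        · refine absurd ⟨k - j', ?_, ?_⟩ hk2
          · simp only [Finset.coe_range, Set.mem_Iio]
            omega
          · simp only
            omega
        · rw [if_neg h2]
          simp
      · rw [if_neg h1]
        simp
    · intro n hn
      rw [Finset.mem_range] at hn
      simp only [hw]
      rw [if_pos ⟨by omega, by omega⟩, if_pos ⟨by omega, by omega⟩]
      congr 2 <;> congr 1 <;> omega
  have hcn : ∀ j ∈ Finset.range H, ∀ j' ∈ Finset.range H,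
      ‖∑ k ∈ Finset.range (N + H), w j k * (starRingEnd ℂ) (w j' k)‖ ≤
        E + if j = j' then (N : ℝ) - E else 0 := by
    intro j hj j' hj'
    rw [Finset.mem_range] at hj hj'
    rcases lt_trichotomy j j' with h | h | h
    · rw [hcorr j j' h.le hj', if_neg h.ne, add_zero]
      exact hE _ (by omega) (by omega)
    · subst h
      rw [hcorr j j le_rfl hj, if_pos rfl, add_sub_cancel]
      refine (norm_sum_le _ _).trans ?_
      refine (Finset.sum_le_card_nsmul _ _ 1 ?_).trans ?_
      · intro n _
        rw [norm_mul, RCLike.norm_conj]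
        simp only [Nat.sub_self, add_zero]
        nlinarith [hu n, norm_nonneg (u n)]
      · simp
    · rw [if_neg h.ne', add_zero]
      have e : ∑ k ∈ Finset.range (N + H), w j k * (starRingEnd ℂ) (w j' k) =
          (starRingEnd ℂ)
            (∑ k ∈ Finset.range (N + H), w j' k * (starRingEnd ℂ) (w j k)) := by
        rw [map_sum]
        refine Finset.sum_congr rfl fun k _ ↦ ?_
        rw [map_mul, Complex.conj_conj, mul_comm]
      rw [e, RCLike.norm_conj, hcorr j' j h.le hj]
      exact hE _ (by omega) (by omega)
  have h1 : (H : ℂ) * ∑ n ∈ Finset.range N, u n = ∑ k ∈ Finset.range (N + H), v k := by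
    simp only [hv]
    rw [Finset.sum_comm, Finset.sum_congr rfl hsum]
    simp
  have h2 : ∑ k ∈ Finset.range (N + H), ‖v k‖ ^ 2 ≤ H * N + H ^ 2 * E := by
    have e : ((∑ k ∈ Finset.range (N + H), ‖v k‖ ^ 2 : ℝ) : ℂ) =
        ∑ j ∈ Finset.range H, ∑ j' ∈ Finset.range H,
          ∑ k ∈ Finset.range (N + H), w j k * (starRingEnd ℂ) (w j' k) := by
      push_cast
      have : ∀ k, ((‖v k‖ : ℂ)) ^ 2 = ∑ j ∈ Finset.range H, ∑ j' ∈ Finset.range H,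
          w j k * (starRingEnd ℂ) (w j' k) := fun k ↦ by
        rw [← Complex.mul_conj', map_sum, Finset.sum_mul_sum]
      simp only [this]
      rw [Finset.sum_comm]
      refine Finset.sum_congr rfl fun j _ ↦ ?_
      rw [Finset.sum_comm]
    have h0 : 0 ≤ ∑ k ∈ Finset.range (N + H), ‖v k‖ ^ 2 :=
      Finset.sum_nonneg fun _ _ ↦ by positivity
    rw [← Complex.norm_of_nonneg h0, e]
    calc _ ≤ ∑ j ∈ Finset.range H, ∑ j' ∈ Finset.range H,
          (E + if j = j' then (N : ℝ) - E else 0) :=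
          (norm_sum_le _ _).trans (Finset.sum_le_sum fun j hj ↦ (norm_sum_le _ _).trans
            (Finset.sum_le_sum fun j' hj' ↦ hcn j hj j' hj'))
      _ = ∑ j ∈ Finset.range H, (H * E + (N - E)) := by
          refine Finset.sum_congr rfl fun j hj ↦ ?_
          rw [Finset.sum_add_distrib, Finset.sum_ite_eq, if_pos hj]
          simp
      _ ≤ _ := by
          simp only [Finset.sum_const, Finset.card_range, nsmul_eq_mul]
          have : 0 ≤ (H : ℝ) * E := by positivity
          nlinarith
  have h3 : H * ‖∑ n ∈ Finset.range N, u n‖ = ‖∑ k ∈ Finset.range (N + H), v k‖ := by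
    rw [← h1, norm_mul, Complex.norm_natCast]
  rw [h3]
  calc _ ≤ (∑ k ∈ Finset.range (N + H), ‖v k‖) ^ 2 := by
        gcongr
        exact norm_sum_le _ _
    _ ≤ (N + H : ℕ) * ∑ k ∈ Finset.range (N + H), ‖v k‖ ^ 2 := by
        simpa using sq_sum_le_card_mul_sum_sq (s := Finset.range (N + H)) (f := fun k ↦ ‖v k‖)
    _ ≤ _ := by
        push_cast
        gcongr

open fwdDiff in
lemma fwdDiff_iter_shift_sub (F : ℕ → ℝ) (h j n : ℕ) :
    Δ_[1] ^[j] (fun k ↦ F (k + h) - F k) n =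
      ∑ i ∈ Finset.range h, Δ_[1] ^[j + 1] F (n + i) := by
  have e : (fun k ↦ F (k + h) - F k) =
      ∑ i ∈ Finset.range h, fun k ↦ Δ_[1] F (k + i) := by
    funext k
    rw [Finset.sum_apply]
    have := Finset.sum_range_sub (fun i ↦ F (k + i)) h
    simpa [fwdDiff, add_assoc] using this.symm
  rw [e, fwdDiff_iter_finsetSum, Finset.sum_apply]
  refine Finset.sum_congr rfl fun i _ ↦ ?_
  rw [fwdDiff_iter_comp_add, Function.iterate_succ_apply]

open fwdDiff in
/-- An exponential sum bound obtained from the Kusmin–Landau inequality by repeated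
van der Corput differencing. -/
lemma norm_sum_unitExp_le_of_fwdDiff_iter (m : ℕ) {N₀ H : ℕ} (hH : 1 ≤ H) (hHN : H ≤ N₀) :
    ∀ {F : ℕ → ℝ} {N : ℕ} {lam mu tau : ℝ}, N ≤ N₀ → 0 < lam → 0 ≤ mu → 0 < tau → tau ≤ 1 →
      1 ≤ H * tau ^ 2 ^ m → 1 ≤ 6 * tau ^ 2 ^ m * N₀ * lam → mu * H ^ m ≤ 1 / 2 →
      (∀ n < N, lam ≤ Δ_[1] ^[m + 1] F n) → (∀ n < N, Δ_[1] ^[m + 1] F n ≤ mu) →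
      (∀ n < N, Δ_[1] ^[m + 2] F n ≤ 0) →
      ‖∑ n ∈ Finset.range N, unitExp (F n)‖ ≤ 6 * tau * N₀ := by
  induction m with
  | zero =>
    intro F N lam mu tau hN hlam hmu htau htau1 _ h1 h2 hlow hup hmono
    have h := norm_sum_unitExp_le_inv hlam (F := F) (N := N) (fun n hn ↦ by simpa using hlow n hn)
      (fun n hn ↦ by
        have := hup n hn
        simp only [zero_add, Function.iterate_one] at this
        simp only [pow_zero, mul_one] at h2
        linarith)
      (fun n hn ↦ by
        have := hmono n hn
        simp only [zero_add, Function.iterate_succ_apply', Function.iterate_zero_apply] at this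
        rw [fwdDiff] at this
        linarith)
    refine h.trans ?_
    rw [div_le_iff₀ hlam]
    simpa using h1
  | succ m ih =>
    intro F N lam mu tau hN hlam hmu htau htau1 h0 h1 h2 hlow hup hmono
    have hH' : (1 : ℝ) ≤ H := by exact_mod_cast hH
    have hHN' : (H : ℝ) ≤ N₀ := by exact_mod_cast hHN
    have hN' : (N : ℝ) ≤ N₀ := by exact_mod_cast hN
    have hp : tau ^ 2 ^ (m + 1) = (tau ^ 2) ^ 2 ^ m := by
      rw [← pow_mul, pow_succ']
    rw [hp] at h0 h1
    have hS := van_der_corput (u := fun n ↦ unitExp (F n)) (fun n ↦ (norm_unitExp _).le) N H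
      (E := 6 * tau ^ 2 * N₀) (by positivity) (fun h hh1 hhH ↦ by
        have hh1' : (1 : ℝ) ≤ h := by exact_mod_cast hh1
        have hhH' : (h : ℝ) ≤ H := by exact_mod_cast hhH.le
        have := ih (F := fun n ↦ F (n + h) - F n) (N := N - h) (lam := lam) (mu := mu * H)
          (tau := tau ^ 2) (by omega) hlam (by positivity) (by positivity)
          (pow_le_one₀ htau.le htau1) h0 h1 (by rw [mul_assoc, ← pow_succ']; exact h2)
          (fun n hn ↦ by
            rw [fwdDiff_iter_shift_sub]
            have := Finset.card_nsmul_le_sum (Finset.range h)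
              (fun i ↦ Δ_[1] ^[m + 1 + 1] F (n + i)) lam
              (fun i hi ↦ hlow _ (by rw [Finset.mem_range] at hi; omega))
            rw [Finset.card_range, nsmul_eq_mul] at this
            refine le_trans ?_ this
            nlinarith)
          (fun n hn ↦ by
            rw [fwdDiff_iter_shift_sub]
            have := Finset.sum_le_card_nsmul (Finset.range h)
              (fun i ↦ Δ_[1] ^[m + 1 + 1] F (n + i)) mu
              (fun i hi ↦ hup _ (by rw [Finset.mem_range] at hi; omega))
            rw [Finset.card_range, nsmul_eq_mul] at this
            refine this.trans ?_
            nlinarith)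
          (fun n hn ↦ by
            rw [fwdDiff_iter_shift_sub]
            exact Finset.sum_nonpos
              fun i hi ↦ hmono _ (by rw [Finset.mem_range] at hi; omega))
        simpa only [unitExp_sub] using this)
    set S := ‖∑ n ∈ Finset.range N, unitExp (F n)‖
    have hq : (tau ^ 2) ^ 2 ^ m ≤ tau ^ 2 :=
      pow_le_of_le_one (by positivity) (pow_le_one₀ htau.le htau1) (by positivity)
    have h3 : 1 ≤ H * tau ^ 2 := h0.trans (by gcongr)
    have h4 : (H * S) ^ 2 ≤ (H * (6 * tau * N₀)) ^ 2 := by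
      calc _ ≤ _ := hS
        _ ≤ (N₀ + N₀) * (H * (H * tau ^ 2) * N₀ + H ^ 2 * (6 * tau ^ 2 * N₀)) := by
          gcongr
          exact le_mul_of_one_le_right (by positivity) h3
        _ = 14 * (H * tau * N₀) ^ 2 := by ring
        _ ≤ _ := by nlinarith [sq_nonneg (H * tau * N₀)]
    have h5 := abs_le_of_sq_le_sq h4 (by positivity)
    exact le_of_mul_le_mul_left ((le_abs_self _).trans h5) (by linarith)

open fwdDiff in
/-- The mean value theorem for iterated forward differences. -/
lemma exists_fwdDiff_iter_eq (n : ℕ) : ∀ {G : ℕ → ℝ → ℝ} {x : ℝ},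
    (∀ j, ∀ y ≥ x, HasDerivAt (G j) (G (j + 1) y) y) →
    ∃ y, x ≤ y ∧ y ≤ x + n ∧ Δ_[1] ^[n] (G 0) x = G n y := by
  induction n with
  | zero => exact fun {G x} _ ↦ ⟨x, le_rfl, by simp, by simp⟩
  | succ n ih =>
    intro G x hG
    obtain ⟨y, hxy, hyx, hy⟩ := ih (G := fun j z ↦ G j (z + 1) - G j z) (x := x)
      (fun j y hy ↦ ((hG j (y + 1) (by linarith)).comp_add_const y 1).sub (hG j y hy))
    obtain ⟨z, hz, hz'⟩ := exists_hasDerivAt_eq_slope (G n) (G (n + 1)) (lt_add_one y)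
      (fun t ht ↦ (hG n t (hxy.trans ht.1)).continuousAt.continuousWithinAt)
      (fun t ht ↦ hG n t (hxy.trans ht.1.le))
    refine ⟨z, hxy.trans hz.1.le, ?_, ?_⟩
    · push_cast
      linarith [hz.2]
    · rw [hz', Function.iterate_succ_apply]
      have : Δ_[1] (G 0) = fun z ↦ G 0 (z + 1) - G 0 z := rfl
      rw [this, hy]
      simp

open fwdDiff in
lemma fwdDiff_iter_natCast_add (f : ℝ → ℝ) (a : ℝ) (j : ℕ) (n : ℕ) :
    Δ_[1] ^[j] (fun k : ℕ ↦ f (a + k)) n = Δ_[1] ^[j] f (a + n) := by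
  induction j generalizing f with
  | zero => rfl
  | succ j ih =>
    have e : Δ_[1] (fun k : ℕ ↦ f (a + k)) = fun k : ℕ ↦ Δ_[1] f (a + k) := by
      funext k
      simp [fwdDiff, add_assoc]
    rw [Function.iterate_succ_apply, Function.iterate_succ_apply, ← ih, e]

open fwdDiff in
lemma exists_fwdDiff_iter_mul_rpow_eq (α c : ℝ) (j : ℕ) {x : ℝ} (hx : 0 < x) :
    ∃ y, x ≤ y ∧ y ≤ x + j ∧ Δ_[1] ^[j] (fun t : ℝ ↦ α * t ^ c) x =
      α * ((∏ i ∈ Finset.range j, (c - i)) * y ^ (c - j)) := by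
  have := exists_fwdDiff_iter_eq j (x := x)
    (G := fun j y ↦ α * ((∏ i ∈ Finset.range j, (c - i)) * y ^ (c - j)))
    (fun j y hy ↦ by
      have h := (((Real.hasDerivAt_rpow_const (x := y) (p := c - j)
        (Or.inl (by linarith))).const_mul (∏ i ∈ Finset.range j, (c - i))).const_mul α)
      refine h.congr_deriv ?_
      rw [Finset.prod_range_succ]
      push_cast
      rw [sub_sub]
      ring)
  simpa using this

open fwdDiff in
/-- Exponential sums along `k ↦ α k ^ c` for non-integral `c > 1`, in a form that saves an
arbitrary small power. -/
lemma exists_norm_sum_unitExp_rpow_le {c : ℝ} (hc : 1 < c) (hcne : ∀ n : ℤ, c ≠ (n : ℝ)) :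
    ∃ P X₀ : ℕ, 1 ≤ P ∧ 1 ≤ X₀ ∧ ∀ X : ℕ, X₀ ≤ X → ∀ K : ℝ, (X : ℝ) ^ P ≤ K →
      ∀ α : ℝ, 1 / (X : ℝ) ≤ α → α ≤ (X : ℝ) ^ 6 →
      ∀ M N : ℕ, K ≤ M → (M : ℝ) ≤ K + 1 → (N : ℝ) ≤ K + 1 →
      ‖∑ n ∈ Finset.range N, unitExp (α * ((M : ℝ) + n) ^ c)‖ ≤ 12 * K / (X : ℝ) ^ 8 := by
  set m := ⌊c⌋₊ with hm
  have hmc : (m : ℝ) < c :=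
    lt_of_le_of_ne (Nat.floor_le (by linarith)) (fun h ↦ hcne m (by exact_mod_cast h.symm))
  have hcm : c < m + 1 := Nat.lt_floor_add_one c
  set β : ℝ := m + 1 - c with hβ
  have hβ0 : 0 < β := by linarith
  have hβ1 : β < 1 := by linarith
  set Q : ℝ := ∏ i ∈ Finset.range (m + 1), (c - i) with hQ
  have hQ0 : 0 < Q := Finset.prod_pos fun i hi ↦ by
    have : (i : ℝ) ≤ m := by exact_mod_cast Nat.lt_succ_iff.1 (Finset.mem_range.1 hi)
    linarith
  obtain ⟨P, hP⟩ := exists_nat_ge (max (max ((7 + 8 * 2 ^ m * m) / β)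
    ((2 + 8 * 2 ^ m) / (1 - β))) (8 * 2 ^ m + 1))
  obtain ⟨X₀, hX₀⟩ := exists_nat_ge (max (max (2 * Q) (1 / Q)) (m + 2))
  simp only [max_le_iff] at hP hX₀
  obtain ⟨⟨hP1, hP2⟩, hP3⟩ := hP
  obtain ⟨⟨hX1, hX2⟩, hX3⟩ := hX₀
  rw [div_le_iff₀ hβ0] at hP1
  rw [div_le_iff₀ (by linarith)] at hP2
  have hP3' : 8 * 2 ^ m + 1 ≤ P := by exact_mod_cast hP3
  have hX3' : m + 2 ≤ X₀ := by exact_mod_cast hX3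
  refine ⟨P, X₀, by omega, by omega, ?_⟩
  intro X hX K hK α hα1 hα2 M N hKM hMK hNK
  have hXX₀ : (X₀ : ℝ) ≤ X := by exact_mod_cast hX
  have hm0 : (0 : ℝ) ≤ m := by positivity
  have hXge1 : (1 : ℝ) ≤ X := by linarith
  have hX0 : (0 : ℝ) < X := by linarith
  set H : ℕ := X ^ (8 * 2 ^ m) with hH
  have hHR : (H : ℝ) = (X : ℝ) ^ (8 * 2 ^ m) := by rw [hH]; push_cast; rfl
  have hH1 : 1 ≤ H := Nat.one_le_pow _ _ (by exact_mod_cast hX0)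
  have hXK : (X : ℝ) ≤ K := by
    refine le_trans ?_ hK
    conv_lhs => rw [← pow_one (X : ℝ)]
    exact pow_le_pow_right₀ hXge1 (by omega)
  have hK0 : 0 < K := by linarith
  have hHK : (H : ℝ) ≤ K := by
    rw [hHR]
    exact (pow_le_pow_right₀ hXge1 (by omega)).trans hK
  have hpow : ∀ (a : ℕ) (γ : ℝ), 0 < γ → (a : ℝ) ≤ P * γ → (X : ℝ) ^ a ≤ K ^ γ := by
    intro a γ hγ ha
    calc (X : ℝ) ^ a = (X : ℝ) ^ (a : ℝ) := (Real.rpow_natCast _ _).symm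
      _ ≤ (X : ℝ) ^ (P * γ) := Real.rpow_le_rpow_of_exponent_le hXge1 ha
      _ = ((X : ℝ) ^ P) ^ γ := by rw [Real.rpow_mul hX0.le, Real.rpow_natCast]
      _ ≤ K ^ γ := Real.rpow_le_rpow (by positivity) hK hγ.le
  have hA : (X : ℝ) ^ 7 * (H : ℝ) ^ m ≤ K ^ β := by
    rw [hHR, ← pow_mul, ← pow_add]
    exact hpow _ _ hβ0 (by push_cast; linarith)
  have hB : (X : ℝ) ^ 2 * H ≤ K ^ (1 - β) := by
    rw [hHR, ← pow_add]
    exact hpow _ _ (by linarith) (by push_cast; linarith)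
  have hα0 : 0 < α := lt_of_lt_of_le (by positivity) hα1
  have hKβ : K ^ (-β) = 1 / K ^ β := by rw [Real.rpow_neg hK0.le, one_div]
  have hKβ0 : 0 < K ^ β := by positivity
  set N₀ := ⌊K⌋₊ + 1 with hN₀
  have hN₀1 : (N₀ : ℝ) ≤ 2 * K := by
    have := Nat.floor_le hK0.le
    rw [hN₀]
    push_cast
    linarith
  have hN₀2 : K ≤ N₀ := by
    have := (Nat.lt_floor_add_one K).le
    rw [hN₀]
    push_cast
    exact this
  have hNN₀ : N ≤ N₀ := by
    rw [hN₀, ← Nat.floor_add_one hK0.le]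
    exact Nat.le_floor hNK
  have hHN₀ : H ≤ N₀ := by exact_mod_cast hHK.trans hN₀2
  have hexp : c - ((m + 1 : ℕ) : ℝ) = -β := by rw [hβ]; push_cast; ring
  have hdiff : ∀ (j n : ℕ), ∃ y, (M : ℝ) + n ≤ y ∧ y ≤ M + n + j ∧
      Δ_[1] ^[j] (fun n : ℕ ↦ α * ((M : ℝ) + n) ^ c) n =
        α * ((∏ i ∈ Finset.range j, (c - i)) * y ^ (c - j)) := by
    intro j n
    rw [fwdDiff_iter_natCast_add (fun t ↦ α * t ^ c)]
    exact exists_fwdDiff_iter_mul_rpow_eq α c j (by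
      have : (0 : ℝ) ≤ n := n.cast_nonneg
      linarith)
  have hmain := norm_sum_unitExp_le_of_fwdDiff_iter m hH1 hHN₀
    (F := fun n : ℕ ↦ α * ((M : ℝ) + n) ^ c) (N := N) (lam := α * (Q * (4 * K) ^ (-β)))
    (mu := α * (Q * K ^ (-β))) (tau := 1 / (X : ℝ) ^ 8) hNN₀ (by positivity) (by positivity)
    (by positivity) ((div_le_one (by positivity)).2 (one_le_pow₀ hXge1))
    (by
      rw [hHR, one_div, inv_pow, ← pow_mul, mul_inv_cancel₀ (by positivity)])
    (by
      rw [one_div, inv_pow, ← pow_mul, ← hHR]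
      have h4 : (1 / 4 : ℝ) ≤ 4 ^ (-β) := by
        rw [Real.rpow_neg (by norm_num), one_div]
        apply inv_anti₀ (by positivity)
        conv_rhs => rw [← Real.rpow_one 4]
        exact Real.rpow_le_rpow_of_exponent_le (by norm_num) hβ1.le
      have hQX : 1 / (X : ℝ) ≤ Q := by
        rw [div_le_iff₀ hX0]
        rw [div_le_iff₀ hQ0] at hX2
        nlinarith
      have hK1 : K ^ (1 - β) = K * K ^ (-β) := by
        rw [sub_eq_add_neg, Real.rpow_add hK0, Real.rpow_one]
      rw [Real.mul_rpow (by norm_num) hK0.le]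
      have hH0 : (0 : ℝ) < H := by exact_mod_cast hH1
      calc (1 : ℝ) ≤ 6 * (H : ℝ)⁻¹ * (1 / X * (1 / X * (1 / 4))) * (X ^ 2 * H) := by
            field_simp
            norm_num
        _ ≤ 6 * (H : ℝ)⁻¹ * (α * (Q * 4 ^ (-β))) * (K * K ^ (-β)) := by
            rw [← hK1]
            gcongr
        _ ≤ 6 * (H : ℝ)⁻¹ * (α * (Q * 4 ^ (-β))) * (N₀ * K ^ (-β)) := by
            gcongr
        _ = _ := by ring)
    (by
      rw [hKβ]
      calc _ ≤ (X : ℝ) ^ 6 * (X / 2 * (1 / K ^ β)) * H ^ m := by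
            gcongr
            linarith
        _ = (X ^ 7 * H ^ m) / K ^ β / 2 := by ring
        _ ≤ 1 / 2 := by
            gcongr
            exact (div_le_one hKβ0).2 hA)
    (fun n hn ↦ by
      obtain ⟨y, hy1, hy2, hy⟩ := hdiff (m + 1) n
      have hn' : (n : ℝ) + 1 ≤ N := by exact_mod_cast hn
      push_cast at hy2
      have hn0 : (0 : ℝ) ≤ n := by positivity
      rw [hy, hexp]
      gcongr α * (Q * ?_)
      exact Real.rpow_le_rpow_of_nonpos (by linarith) (by linarith) (by linarith))
    (fun n hn ↦ by
      obtain ⟨y, hy1, hy2, hy⟩ := hdiff (m + 1) n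
      have hn0 : (0 : ℝ) ≤ n := by positivity
      rw [hy, hexp]
      gcongr α * (Q * ?_)
      exact Real.rpow_le_rpow_of_nonpos (by linarith) (by linarith) (by linarith))
    (fun n hn ↦ by
      obtain ⟨y, hy1, hy2, hy⟩ := hdiff (m + 2) n
      have hn0 : (0 : ℝ) ≤ n := by positivity
      rw [hy, Finset.prod_range_succ, hexp]
      have hy0 : 0 < y := by linarith
      have : 0 ≤ α * (Q * β * y ^ (c - (m + 2 : ℕ))) := by positivity
      linarith)
  refine hmain.trans ?_
  calc _ ≤ 6 * (1 / (X : ℝ) ^ 8) * (2 * K) := by gcongr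
    _ = _ := by ring

lemma norm_geom_sum_unitExp_sq_le {t δ : ℝ} (hδ : 0 < δ) (ht : ∀ n : ℤ, δ ≤ |t - n|) (H : ℕ) :
    ‖∑ a ∈ Finset.range H, unitExp (a * t)‖ ^ 2 ≤ 1 / (4 * δ ^ 2) := by
  have h1 : unitExp t = unitExp (t - round t) := by
    have := unitExp_add (t - round t) (round t)
    rwa [unitExp_intCast, mul_one, sub_add_cancel] at this
  have h2 : 4 * δ ≤ ‖unitExp t - 1‖ := by
    rw [h1]
    exact (mul_le_mul_of_nonneg_left (ht (round t)) (by norm_num)).trans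
      (four_mul_le_norm_unitExp_sub_one (abs_sub_round t))
  have h3 : ‖∑ a ∈ Finset.range H, unitExp (a * t)‖ * ‖unitExp t - 1‖ ≤ 2 := by
    simp only [unitExp_nsmul]
    rw [← norm_mul, geom_sum_mul]
    refine (norm_sub_le _ _).trans ?_
    rw [norm_pow, norm_unitExp, norm_one]
    norm_num
  have h4 : ‖∑ a ∈ Finset.range H, unitExp (a * t)‖ * (2 * δ) ≤ 1 := by
    nlinarith [norm_nonneg (∑ a ∈ Finset.range H, unitExp (a * t))]
  rw [le_div_iff₀ (by positivity)]
  calc _ = (‖∑ a ∈ Finset.range H, unitExp (a * t)‖ * (2 * δ)) ^ 2 := by ring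
    _ ≤ 1 := pow_le_one₀ (by positivity) h4

/-- The mean of the (unnormalised) Fejér kernel over a finite sequence with small exponential
sums. -/
lemma abs_sum_fejer_sub_le {y : ℕ → ℝ} {N H : ℕ} {E : ℝ} (hE0 : 0 ≤ E)
    (hE : ∀ h : ℕ, 1 ≤ h → h < H → ‖∑ n ∈ Finset.range N, unitExp (h * y n)‖ ≤ E) (s : ℝ) :
    |∑ n ∈ Finset.range N, ‖∑ a ∈ Finset.range H, unitExp (a * (y n - s))‖ ^ 2 - H * N| ≤
      H ^ 2 * E := by
  have hlt : ∀ a b : ℕ, b < a → a < H →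
      ‖∑ n ∈ Finset.range N, unitExp (a * (y n - s)) *
        (starRingEnd ℂ) (unitExp (b * (y n - s)))‖ ≤ E := by
    intro a b hba ha
    have e : ∀ n, unitExp (a * (y n - s)) * (starRingEnd ℂ) (unitExp (b * (y n - s))) =
        unitExp ((a - b : ℕ) * y n) * unitExp (-((a - b : ℕ) * s)) := fun n ↦ by
      rw [← unitExp_sub, ← unitExp_add, Nat.cast_sub hba.le]
      congr 1
      ring
    simp only [e]
    rw [← Finset.sum_mul, norm_mul, norm_unitExp, mul_one]
    exact hE _ (by omega) (by omega)
  have e1 : ((∑ n ∈ Finset.range N,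
      ‖∑ a ∈ Finset.range H, unitExp (a * (y n - s))‖ ^ 2 - H * N : ℝ) : ℂ) =
      ∑ a ∈ Finset.range H, ∑ b ∈ Finset.range H,
        (∑ n ∈ Finset.range N, unitExp (a * (y n - s)) *
          (starRingEnd ℂ) (unitExp (b * (y n - s))) - if a = b then (N : ℂ) else 0) := by
    have h1 : ∀ n, ((‖∑ a ∈ Finset.range H, unitExp (a * (y n - s))‖ : ℂ)) ^ 2 =
        ∑ a ∈ Finset.range H, ∑ b ∈ Finset.range H, unitExp (a * (y n - s)) *
          (starRingEnd ℂ) (unitExp (b * (y n - s))) := fun n ↦ by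
      rw [← Complex.mul_conj', map_sum, Finset.sum_mul_sum]
    push_cast
    simp only [h1, Finset.sum_sub_distrib, Finset.sum_ite_eq]
    congr 1
    · rw [Finset.sum_comm]
      refine Finset.sum_congr rfl fun a _ ↦ ?_
      rw [Finset.sum_comm]
    · rw [Finset.sum_congr rfl (fun a ha ↦ if_pos ha)]
      simp
  rw [← Real.norm_eq_abs, ← Complex.norm_real, e1]
  calc _ ≤ ∑ a ∈ Finset.range H, ∑ b ∈ Finset.range H, E := by
        refine (norm_sum_le _ _).trans (Finset.sum_le_sum fun a ha ↦ (norm_sum_le _ _).trans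
          (Finset.sum_le_sum fun b hb ↦ ?_))
        rw [Finset.mem_range] at ha hb
        rcases lt_trichotomy a b with h | h | h
        · rw [if_neg h.ne, sub_zero, ← RCLike.norm_conj, map_sum]
          simp only [map_mul, Complex.conj_conj]
          simp only [mul_comm ((starRingEnd ℂ) _)]
          exact hlt b a h hb
        · subst h
          rw [if_pos rfl]
          simp only [← unitExp_sub, sub_self, unitExp_zero]
          simpa using hE0
        · rw [if_neg h.ne', sub_zero]
          exact hlt a b h ha
    _ = _ := by
        simp only [Finset.sum_const, Finset.card_range, nsmul_eq_mul]
        ring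

lemma sum_fejer_grid (y : ℝ) {H M : ℕ} (hHM : H ≤ M) :
    ∑ j ∈ Finset.range M, ‖∑ a ∈ Finset.range H, unitExp (a * (y - j / M))‖ ^ 2 = H * M := by
  have h := abs_sum_fejer_sub_le (y := fun j ↦ -((j : ℝ) / M)) (N := M) (H := H) le_rfl
    (fun h hh1 hhH ↦ by
      have hM0 : (0 : ℝ) < M := by exact_mod_cast (by omega : 0 < M)
      have hh0 : (0 : ℝ) < h := by exact_mod_cast hh1
      have hhM : (h : ℝ) < M := by exact_mod_cast hhH.trans_le hHM
      have e : ∀ j : ℕ, unitExp (h * -((j : ℝ) / M)) = unitExp (-(h / M)) ^ j := fun j ↦ by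
        rw [← unitExp_nsmul]
        congr 1
        ring
      simp only [e]
      have hne : unitExp (-(h / M)) - 1 ≠ 0 := by
        rw [← norm_pos_iff, norm_unitExp_sub_one, mul_neg, Real.sin_neg, abs_neg]
        have : 0 < Real.sin (Real.pi * (h / M)) := by
          apply Real.sin_pos_of_pos_of_lt_pi
          · positivity
          · have : (h : ℝ) / M < 1 := (div_lt_one hM0).2 hhM
            nlinarith [Real.pi_pos]
        positivity
      have hs : (∑ j ∈ Finset.range M, unitExp (-(h / M)) ^ j) * (unitExp (-(h / M)) - 1) = 0 := by
        rw [geom_sum_mul, ← unitExp_nsmul]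
        have : (M : ℝ) * -(h / M) = ((-(h : ℤ) : ℤ) : ℝ) := by
          push_cast
          field_simp
        rw [this, unitExp_intCast, sub_self]
      rw [(mul_eq_zero.1 hs).resolve_right hne, norm_zero]) (-y)
  rw [mul_zero] at h
  have h2 := sub_eq_zero.1 (abs_nonpos_iff.1 h)
  rw [← h2]
  refine Finset.sum_congr rfl fun j _ ↦ ?_
  simp only [sub_neg_eq_add, neg_add_eq_sub]

/-- A lower bound for the number of `n < N` with `⌊z n⌋ ≡ r (mod q)` in terms of exponential
sums. -/
lemma le_card_floor_emod_eq {z : ℕ → ℝ} {N q H T : ℕ} {E : ℝ} (hq : 0 < q) (hH : 0 < H)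
    (hT : 2 ≤ T) (hE0 : 0 ≤ E)
    (hE : ∀ h : ℕ, 1 ≤ h → h < H → ‖∑ n ∈ Finset.range N, unitExp (h * (z n / q))‖ ≤ E)
    {r : ℕ} (hr : r < q) :
    (N : ℝ) / q - (2 * N / (T * q) + H * E + N * q ^ 2 * T ^ 2 / (4 * H)) ≤
      ((Finset.range N).filter (fun n ↦ ⌊z n⌋ % (q : ℤ) = r)).card := by
  set M : ℕ := q * (H * T) with hM
  have hq' : (0 : ℝ) < q := by exact_mod_cast hq
  have hH' : (0 : ℝ) < H := by exact_mod_cast hH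
  have hT' : (2 : ℝ) ≤ T := by exact_mod_cast hT
  have hT0 : (0 : ℝ) < T := by linarith
  have hMR : (M : ℝ) = q * (H * T) := by rw [hM]; push_cast; ring
  set J : Finset ℕ := Finset.Ico (r * (H * T) + H) (r * (H * T) + H * T - H) with hJ
  have hHT : H * 2 ≤ H * T := Nat.mul_le_mul_left _ hT
  have hJc : (J.card : ℝ) = H * (T - 2) := by
    rw [hJ, Nat.card_Ico, Nat.sub_sub, Nat.cast_sub (by omega)]
    push_cast
    ring
  have hJM : J ⊆ Finset.range M := by
    intro j hj
    rw [hJ, Finset.mem_Ico] at hj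
    rw [Finset.mem_range]
    have : (r + 1) * (H * T) ≤ q * (H * T) := Nat.mul_le_mul_right _ hr
    rw [add_mul, one_mul] at this
    omega
  set G : ℕ → ℕ → ℝ := fun n j ↦
    ‖∑ a ∈ Finset.range H, unitExp (a * (z n / q - j / M))‖ ^ 2 with hG
  have hG0 : ∀ n j, 0 ≤ G n j := fun n j ↦ by positivity
  set good := (Finset.range N).filter (fun n ↦ ⌊z n⌋ % (q : ℤ) = r) with hgood
  have hHM : H ≤ M := by
    rw [hM]
    nlinarith
  have hupper : ∀ n, ∑ j ∈ J, G n j ≤ H * M := fun n ↦ by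
    rw [← sum_fejer_grid (z n / q) hHM]
    exact Finset.sum_le_sum_of_subset_of_nonneg hJM fun j _ _ ↦ hG0 n j
  have hbad : ∀ n, ⌊z n⌋ % (q : ℤ) ≠ r → ∀ j ∈ J, G n j ≤ q ^ 2 * T ^ 2 / 4 := by
    intro n hn j hj
    have := norm_geom_sum_unitExp_sq_le (t := z n / q - j / M) (δ := 1 / (q * T))
      (by positivity) (fun k ↦ by
        by_contra hlt
        rw [not_le, abs_lt] at hlt
        apply hn
        rw [hJ, Finset.mem_Ico] at hj
        have hj1 : (r : ℝ) * (H * T) + H ≤ j := by exact_mod_cast hj.1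
        have hj2 : (j : ℝ) + H ≤ r * (H * T) + H * T := by
          exact_mod_cast (by omega : j + H ≤ r * (H * T) + H * T)
        have e : (z n / q - j / M - k) = (z n - j / (H * T) - k * q) / q := by
          rw [hMR]
          field_simp
        have e2 : (1 : ℝ) / (q * T) = 1 / T / q := by field_simp
        rw [e, e2, ← neg_div, div_lt_div_iff_of_pos_right hq', div_lt_div_iff_of_pos_right hq']
          at hlt
        have hj1' : (r : ℝ) + 1 / T ≤ j / (H * T) := by
          rw [le_div_iff₀ (by positivity)]
          calc _ = (r : ℝ) * (H * T) + H := by field_simp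
            _ ≤ _ := hj1
        have hj2' : (j : ℝ) / (H * T) ≤ r + 1 - 1 / T := by
          rw [div_le_iff₀ (by positivity)]
          calc (j : ℝ) ≤ r * (H * T) + H * T - H := by linarith
            _ = _ := by field_simp
        have hfl : ⌊z n⌋ = r + k * q := by
          rw [Int.floor_eq_iff]
          push_cast
          constructor <;> linarith [hlt.1, hlt.2]
        rw [hfl, Int.add_mul_emod_self_right, Int.emod_eq_of_lt (by positivity)
          (by exact_mod_cast hr)]) H
    refine this.trans (le_of_eq ?_)
    field_simp
  have hlow : ∀ j, H * N - H ^ 2 * E ≤ ∑ n ∈ Finset.range N, G n j := fun j ↦ by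
    have := (abs_le.1 (abs_sum_fejer_sub_le hE0 hE ((j : ℝ) / M))).1
    simp only [hG]
    linarith
  have h1 : J.card * (H * N - H ^ 2 * E) ≤ ∑ n ∈ Finset.range N, ∑ j ∈ J, G n j := by
    rw [Finset.sum_comm, ← nsmul_eq_mul]
    exact Finset.card_nsmul_le_sum _ _ _ fun j _ ↦ hlow j
  have h2 : ∑ n ∈ Finset.range N, ∑ j ∈ J, G n j ≤
      good.card * (H * M) + N * (J.card * (q ^ 2 * T ^ 2 / 4)) := by
    rw [← Finset.sum_filter_add_sum_filter_not _ (fun n ↦ ⌊z n⌋ % (q : ℤ) = r)]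
    refine add_le_add ?_ ?_
    · rw [← nsmul_eq_mul]
      exact Finset.sum_le_card_nsmul _ _ _ fun n _ ↦ hupper n
    · refine (Finset.sum_le_card_nsmul _ _ (J.card * (q ^ 2 * T ^ 2 / 4) : ℝ) ?_).trans ?_
      · intro n hn
        rw [← nsmul_eq_mul]
        exact Finset.sum_le_card_nsmul _ _ _ (hbad n (Finset.mem_filter.1 hn).2)
      · rw [nsmul_eq_mul]
        gcongr
        exact (Finset.card_filter_le _ _).trans (by simp)
  have h3 := h1.trans h2
  rw [hJc, hMR] at h3
  have h4 : (T - 2 : ℝ) / (q * T) * (N - H * E - N * q ^ 2 * T ^ 2 / (4 * H)) ≤ good.card := by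
    have hp : (0 : ℝ) < H * (q * (H * T)) := by positivity
    refine le_of_mul_le_mul_right ?_ hp
    calc _ = H * (T - 2) * (H * N - H ^ 2 * E) - N * (H * (T - 2) * (q ^ 2 * T ^ 2 / 4)) := by
          field_simp
      _ ≤ _ := by linarith
  refine le_trans ?_ h4
  have hq1 : (1 : ℝ) ≤ q := by exact_mod_cast hq
  have h5 : (T - 2 : ℝ) / (q * T) ≤ 1 := by
    rw [div_le_one (by positivity)]
    nlinarith
  have h6 : (0 : ℝ) ≤ H * E + N * q ^ 2 * T ^ 2 / (4 * H) := by positivity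
  have h7 : (T - 2 : ℝ) / (q * T) * N = N / q - 2 * N / (T * q) := by
    field_simp
  nlinarith

/-- Equidistribution of `⌊z n⌋` modulo `q` in terms of exponential sums. -/
lemma abs_card_floor_emod_eq_sub_le {z : ℕ → ℝ} {N q H T : ℕ} {E : ℝ} (hq : 0 < q) (hH : 0 < H)
    (hT : 2 ≤ T) (hE0 : 0 ≤ E)
    (hE : ∀ h : ℕ, 1 ≤ h → h < H → ‖∑ n ∈ Finset.range N, unitExp (h * (z n / q))‖ ≤ E)
    {r : ℕ} (hr : r < q) :
    |(((Finset.range N).filter (fun n ↦ ⌊z n⌋ % (q : ℤ) = r)).card : ℝ) - N / q| ≤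
      q * (2 * N / (T * q) + H * E + N * q ^ 2 * T ^ 2 / (4 * H)) := by
  set D : ℝ := 2 * N / (T * q) + H * E + N * q ^ 2 * T ^ 2 / (4 * H) with hD
  have hD0 : 0 ≤ D := by positivity
  have hq1 : (1 : ℝ) ≤ q := by exact_mod_cast hq
  have hlow : ∀ s ∈ Finset.range q, (N : ℝ) / q - D ≤
      ((Finset.range N).filter (fun n ↦ ⌊z n⌋ % (q : ℤ) = s)).card :=
    fun s hs ↦ le_card_floor_emod_eq hq hH hT hE0 hE (Finset.mem_range.1 hs)
  have htot : ∑ s ∈ Finset.range q,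
      (((Finset.range N).filter (fun n ↦ ⌊z n⌋ % (q : ℤ) = s)).card : ℝ) = N := by
    have h := Finset.card_eq_sum_card_fiberwise (s := Finset.range N) (t := Finset.range q)
      (f := fun n ↦ (⌊z n⌋ % (q : ℤ)).toNat) (fun n _ ↦ by
        have h1 := Int.emod_lt_of_pos ⌊z n⌋ (by exact_mod_cast hq : (0 : ℤ) < q)
        have h2 := Int.emod_nonneg ⌊z n⌋ (by exact_mod_cast hq.ne' : (q : ℤ) ≠ 0)
        simp only [Finset.coe_range, Set.mem_Iio]
        omega)
    rw [Finset.card_range] at h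
    conv_rhs => rw [h]
    push_cast
    refine Finset.sum_congr rfl fun s _ ↦ ?_
    congr 2
    refine Finset.filter_congr fun n _ ↦ ?_
    have h2 := Int.emod_nonneg ⌊z n⌋ (by exact_mod_cast hq.ne' : (q : ℤ) ≠ 0)
    omega
  have hr' := Finset.mem_range.2 hr
  rw [← Finset.add_sum_erase _ _ hr'] at htot
  have hrest := Finset.card_nsmul_le_sum ((Finset.range q).erase r) _ _
    (fun s hs ↦ hlow s (Finset.mem_of_mem_erase hs))
  rw [Finset.card_erase_of_mem hr', Finset.card_range, nsmul_eq_mul,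
    Nat.cast_sub (by omega), Nat.cast_one] at hrest
  have e : ((q : ℝ) - 1) * (N / q - D) = N - N / q - (q - 1) * D := by
    have : (q : ℝ) ≠ 0 := by positivity
    field_simp
  rw [abs_le]
  constructor
  · nlinarith [hlow r hr']
  · nlinarith

lemma exists_abs_card_floor_rpow_emod_eq_sub_le {c : ℝ} (hc : 1 < c)
    (hcne : ∀ n : ℤ, c ≠ (n : ℝ)) :
    ∃ P X₀ : ℕ, ∀ X : ℕ, X₀ ≤ X → ∀ K K₁ : ℝ, (X : ℝ) ^ P ≤ K → K ≤ K₁ → K₁ ≤ 2 * K →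
      ∀ q : ℕ, 0 < q → q ≤ X → ∀ ℓ : ℤ,
        |(((Finset.Ioc ⌊K⌋ ⌊K₁⌋).filter
            (fun k : ℤ ↦ ⌊(k : ℝ) ^ c⌋ % (q : ℤ) = ℓ % q)).card : ℝ) - (K₁ - K) / q| ≤
          18 * K / X := by
  obtain ⟨P, X₀, hP, hX₀, hexp⟩ := exists_norm_sum_unitExp_rpow_le hc hcne
  refine ⟨P, X₀ + 2, fun X hX K K₁ hXK hK1 hK2 q hq hqX ℓ ↦ ?_⟩
  have hX2 : (2 : ℝ) ≤ X := by exact_mod_cast (by omega : 2 ≤ X)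
  have hX0 : (0 : ℝ) < X := by linarith
  have hXleK : (X : ℝ) ≤ K := by
    refine le_trans ?_ hXK
    conv_lhs => rw [← pow_one (X : ℝ)]
    exact pow_le_pow_right₀ (by linarith) hP
  have hK0 : 0 < K := by linarith
  have hq1 : (1 : ℝ) ≤ q := by exact_mod_cast hq
  have hqX' : (q : ℝ) ≤ X := by exact_mod_cast hqX
  obtain ⟨M, hM⟩ : ∃ M : ℕ, (M : ℤ) = ⌊K⌋ + 1 :=
    ⟨(⌊K⌋ + 1).toNat, Int.toNat_of_nonneg (by have := Int.floor_nonneg.2 hK0.le; omega)⟩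
  obtain ⟨N, hN⟩ : ∃ N : ℕ, (N : ℤ) = ⌊K₁⌋ - ⌊K⌋ :=
    ⟨(⌊K₁⌋ - ⌊K⌋).toNat, Int.toNat_of_nonneg (by have := Int.floor_mono hK1; omega)⟩
  have hMR : (M : ℝ) = ⌊K⌋ + 1 := by exact_mod_cast hM
  have hNR : (N : ℝ) = ⌊K₁⌋ - ⌊K⌋ := by exact_mod_cast hN
  have f1 := Int.floor_le K
  have f2 := Int.lt_floor_add_one K
  have f3 := Int.floor_le K₁
  have f4 := Int.lt_floor_add_one K₁
  have hN2 : (N : ℝ) ≤ 2 * K := by linarith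
  obtain ⟨r, hr⟩ : ∃ r : ℕ, (r : ℤ) = ℓ % q :=
    ⟨(ℓ % q).toNat, Int.toNat_of_nonneg (Int.emod_nonneg _ (by omega))⟩
  have hrq : r < q := by
    have := Int.emod_lt_of_pos ℓ (by omega : (0 : ℤ) < q)
    omega
  have hcard : ((Finset.Ioc ⌊K⌋ ⌊K₁⌋).filter
      (fun k : ℤ ↦ ⌊(k : ℝ) ^ c⌋ % (q : ℤ) = ℓ % q)).card =
      ((Finset.range N).filter
        (fun n : ℕ ↦ ⌊((M : ℝ) + n) ^ c⌋ % (q : ℤ) = r)).card := by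
    symm
    refine Finset.card_bij (fun (n : ℕ) _ ↦ (M : ℤ) + n) ?_ ?_ ?_
    · intro n hn
      rw [Finset.mem_filter, Finset.mem_range] at hn
      rw [Finset.mem_filter, Finset.mem_Ioc, ← hr]
      refine ⟨by omega, ?_⟩
      push_cast
      exact hn.2
    · intro a _ b _ h
      simpa using h
    · intro k hk
      rw [Finset.mem_filter, Finset.mem_Ioc, ← hr] at hk
      have hk' : (M : ℤ) + ((k - M).toNat : ℤ) = k := by omega
      refine ⟨(k - M).toNat, ?_, hk'⟩
      rw [Finset.mem_filter, Finset.mem_range]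
      refine ⟨by omega, ?_⟩
      have : (M : ℝ) + ((k - M).toNat : ℝ) = k := by exact_mod_cast hk'
      rw [this]
      exact hk.2
  have hmain := abs_card_floor_emod_eq_sub_le (z := fun n : ℕ ↦ ((M : ℝ) + n) ^ c) (N := N)
    (q := q) (H := X ^ 6) (T := X) (E := 12 * K / (X : ℝ) ^ 8) hq (pow_pos (by omega) 6)
    (by omega) (by positivity) (fun h hh1 hhH ↦ by
      have hh1' : (1 : ℝ) ≤ h := by exact_mod_cast hh1
      have hhH' : (h : ℝ) ≤ (X : ℝ) ^ 6 := by exact_mod_cast hhH.le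
      have := hexp X (by omega) K hXK (h / q) (div_le_div₀ (by linarith) hh1' (by linarith) hqX')
        ((div_le_self (by linarith) hq1).trans hhH') M N (by linarith) (by linarith) (by linarith)
      simpa only [div_mul_eq_mul_div, mul_div_assoc] using this) hrq
  rw [hcard]
  have hbound : (q : ℝ) * (2 * N / (X * q) + (X ^ 6 : ℕ) * (12 * K / (X : ℝ) ^ 8) +
      N * q ^ 2 * X ^ 2 / (4 * (X ^ 6 : ℕ))) ≤ 17 * K / X := by
    push_cast
    calc _ = 2 * N / X + q * (12 * K / (X : ℝ) ^ 2) + q ^ 3 * N / (4 * X ^ 4) := by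
          field_simp
      _ ≤ 2 * (2 * K) / X + X * (12 * K / (X : ℝ) ^ 2) + X ^ 3 * (2 * K) / (4 * X ^ 4) := by
          gcongr
      _ = 33 / 2 * K / X := by
          field_simp
          ring
      _ ≤ _ := by
          gcongr
          norm_num
  have hfrac : |(N : ℝ) / q - (K₁ - K) / q| ≤ 1 := by
    rw [← sub_div, abs_div, abs_of_pos (by linarith : (0 : ℝ) < q)]
    refine (div_le_self (abs_nonneg _) hq1).trans ?_
    rw [abs_le]
    constructor <;> linarith
  have hone : 1 ≤ K / X := (one_le_div hX0).2 hXleK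
  calc _ ≤ _ := abs_sub_le _ ((N : ℝ) / q) _
    _ ≤ 17 * K / X + K / X := add_le_add (hmain.trans hbound) (hfrac.trans hone)
    _ = _ := by ring

theorem statement8 (c : ℝ) (hc : 1 < c) (hcne : ∀ n : ℤ, c ≠ (n : ℝ))
    (A B C₅ : ℝ) (hA : 1 < A) (hB : 0 < B) (hC₅ : 0 < C₅) :
    ∃ κ > (0:ℝ), ∃ x₀ : ℝ, 2 ≤ x₀ ∧ ∀ x : ℝ, x₀ ≤ x →
      ∀ K K₁ : ℝ, K ≤ K₁ → K₁ ≤ 2 * K →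
        x * Real.log x ^ (-B) ≤ K ^ c → K ^ c ≤ x →
        ∀ q : ℤ, 1 < q → (q : ℝ) ≤ Real.log x ^ C₅ → ∀ ℓ : ℤ,
          |(((Finset.Ioc ⌊K⌋ ⌊K₁⌋).filter
                (fun k : ℤ => ⌊(k : ℝ) ^ c⌋ % q = ℓ % q)).card : ℝ)
              - (K₁ - K) / (q : ℝ)|
            ≤ κ * K * Real.log x ^ (-(4 * A)) := by
  obtain ⟨P, X₀, hcore⟩ := exists_abs_card_floor_rpow_emod_eq_sub_le hc hcne
  set p : ℝ := max (4 * A) C₅ with hp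
  have hp0 : 0 < p := hC₅.trans_le (le_max_right _ _)
  have ev1 : ∀ᶠ x in Filter.atTop, (X₀ : ℝ) ≤ Real.log x ^ p :=
    ((tendsto_rpow_atTop hp0).comp Real.tendsto_log_atTop).eventually_ge_atTop _
  have ev2 : ∀ᶠ x in Filter.atTop, 1 ≤ Real.log x :=
    Real.tendsto_log_atTop.eventually_ge_atTop _
  have ev3 : ∀ᶠ x in Filter.atTop,
      ‖Real.log x ^ (p * (P * c) + B)‖ ≤ (2 ^ (P * c) : ℝ)⁻¹ * ‖x ^ (1 : ℝ)‖ :=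
    (isLittleO_log_rpow_rpow_atTop _ one_pos).def (by positivity)
  obtain ⟨x₁, hx₁⟩ := Filter.eventually_atTop.1 (ev1.and (ev2.and ev3))
  refine ⟨18, by norm_num, max 2 x₁, le_max_left _ _, ?_⟩
  intro x hx K K₁ hK1 hK2 hKc _ q hq hqL ℓ
  have hx2 : 2 ≤ x := (le_max_left _ _).trans hx
  obtain ⟨hX₀, hL, hlog⟩ := hx₁ x ((le_max_right _ _).trans hx)
  set L := Real.log x with hLdef
  have hL0 : 0 < L := by linarith
  have hLp1 : 1 ≤ L ^ p := Real.one_le_rpow hL hp0.le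
  set X : ℕ := ⌈L ^ p⌉₊ with hX
  have hX1 : L ^ p ≤ X := Nat.le_ceil _
  have hX2 : (X : ℝ) ≤ 2 * L ^ p := by
    have := Nat.ceil_lt_add_one (a := L ^ p) (by positivity)
    linarith
  have hK0 : 0 ≤ K := by linarith
  have hXK : (X : ℝ) ^ P ≤ K := by
    rw [← Real.rpow_le_rpow_iff (by positivity) hK0 (by linarith : 0 < c)]
    refine le_trans ?_ hKc
    rw [Real.rpow_one, Real.norm_of_nonneg (by positivity), Real.norm_of_nonneg (by linarith),
      inv_mul_eq_div, le_div_iff₀ (by positivity), Real.rpow_add hL0] at hlog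
    rw [Real.rpow_neg hL0.le, ← div_eq_mul_inv, le_div_iff₀ (by positivity)]
    calc ((X : ℝ) ^ P) ^ c * L ^ B = (X : ℝ) ^ (P * c) * L ^ B := by
          rw [Real.rpow_mul (by positivity), Real.rpow_natCast]
      _ ≤ (2 * L ^ p) ^ (P * c) * L ^ B := by gcongr
      _ = L ^ (p * (P * c)) * L ^ B * 2 ^ (P * c) := by
          rw [Real.mul_rpow (by norm_num) (by positivity), ← Real.rpow_mul hL0.le]
          ring
      _ ≤ x := hlog
  lift q to ℕ using by omega
  have hqX : q ≤ X := by
    have h : (q : ℝ) ≤ X := by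
      refine le_trans ?_ hX1
      refine le_trans (by exact_mod_cast hqL) ?_
      exact Real.rpow_le_rpow_of_exponent_le hL (le_max_right _ _)
    exact_mod_cast h
  have h := hcore X (by exact_mod_cast hX₀.trans hX1) K K₁ hXK hK1 hK2 q (by omega) hqX ℓ
  rw [Int.cast_natCast]
  refine h.trans ?_
  rw [Real.rpow_neg hL0.le, ← div_eq_mul_inv]
  have h4A : L ^ (4 * A) ≤ X :=
    (Real.rpow_le_rpow_of_exponent_le hL (le_max_left _ _)).trans hX1
  gcongr
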